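/- For n = 2 and k = 3, exactly 48 of the 8! = 40320 permutations σ of W_2^3 satisfy both condition (b) and condition (d). (By the Conti–Szymański criterion these are exactly the permutations of level 3 whose associated permutative endomorphism λ_σ is an automorphism of the Cuntz algebra O_2.) -/

import Mathlib

section CondBD

/-- The chain `α, f_{i₁}^σ(α), f_{i₂}^σ(f_{i₁}^σ(α)), …`, where for a
permutation `σ` of the words of length `k+1` over `{1,…,n}` and a letter `i`,
`f_i^σ(α)` is the word formed by the first `k` letters of `σ(iα)`. -/
def cuntzChainB {n k : ℕ} (σ : Equiv.Perm (Fin (k + 1) → Fin n)) (seq : ℕ → Fin n)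
    (α : Fin k → Fin n) : ℕ → (Fin k → Fin n)
  | 0 => α
  | m + 1 => Fin.init (σ (Fin.cons (seq m) (cuntzChainB σ seq α m)))

/-- Condition (b): for all words `α ≠ β` of length `k` and every sequence of
letters, some composite `f_{i_m}^σ ∘ ⋯ ∘ f_{i_1}^σ` takes the same value at
`α` and `β`. -/
def cuntzCondB {n k : ℕ} (σ : Equiv.Perm (Fin (k + 1) → Fin n)) : Prop :=
  ∀ α β : Fin k → Fin n, α ≠ β → ∀ seq : ℕ → Fin n,
    ∃ m : ℕ, 1 ≤ m ∧ cuntzChainB σ seq α m = cuntzChainB σ seq β m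

/-- The map `f_{ij}^σ` on pairs of words (with `none` playing the role of `†`):
`f_{ij}^σ(α,β) = (γ,δ)` if `σ(iα)` and `σ(jβ)` share the same last letter,
where `γ, δ` consist of the first `k` letters of `σ(iα)`, `σ(jβ)`;
otherwise `f_{ij}^σ(α,β) = †`, and `f_{ij}^σ(†) = †`. -/
def cuntzStepD {n k : ℕ} (σ : Equiv.Perm (Fin (k + 1) → Fin n)) (p : Fin n × Fin n) :
    Option ((Fin k → Fin n) × (Fin k → Fin n)) →
      Option ((Fin k → Fin n) × (Fin k → Fin n))
  | none => none
  | some q =>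
      if (σ (Fin.cons p.1 q.1)) (Fin.last k) = (σ (Fin.cons p.2 q.2)) (Fin.last k) then
        some (Fin.init (σ (Fin.cons p.1 q.1)), Fin.init (σ (Fin.cons p.2 q.2)))
      else none

/-- The chain `x, f_{i₁j₁}^σ(x), f_{i₂j₂}^σ(f_{i₁j₁}^σ(x)), …`. -/
def cuntzChainD {n k : ℕ} (σ : Equiv.Perm (Fin (k + 1) → Fin n))
    (seq : ℕ → Fin n × Fin n) (x : Option ((Fin k → Fin n) × (Fin k → Fin n))) :
    ℕ → Option ((Fin k → Fin n) × (Fin k → Fin n))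
  | 0 => x
  | m + 1 => cuntzStepD σ (seq m) (cuntzChainD σ seq x m)

/-- Condition (d): for every element `x` of
`𝕎 = {(α,β) : α ≠ β} ∪ {†}` and every sequence of pairs of letters, some
composite `f_{i_mj_m}^σ ∘ ⋯ ∘ f_{i_1j_1}^σ` sends `x` to `†`. -/
def cuntzCondD {n k : ℕ} (σ : Equiv.Perm (Fin (k + 1) → Fin n)) : Prop :=
  ∀ x : Option ((Fin k → Fin n) × (Fin k → Fin n)),
    (∀ q, x = some q → q.1 ≠ q.2) →
    ∀ seq : ℕ → Fin n × Fin n, ∃ m : ℕ, 1 ≤ m ∧ cuntzChainD σ seq x m = none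

end CondBD

section Walks

variable {α : Type*}

/-- The elements from which a walk of length `t` along `R` starts. -/
def walkStarts (R : α → α → Prop) : ℕ → Set α
  | 0 => Set.univ
  | t + 1 => {p | ∃ q ∈ walkStarts R t, R p q}

theorem walkStarts_antitone (R : α → α → Prop) : Antitone (walkStarts R) := by
  refine antitone_nat_of_succ_le fun t => ?_
  induction t with
  | zero => exact Set.subset_univ _
  | succ t ih => exact fun p ⟨q, hq, hpq⟩ => ⟨q, ih hq, hpq⟩

theorem exists_walk_of_walkStarts_succ_eq {R : α → α → Prop} {t : ℕ}
    (h : walkStarts R (t + 1) = walkStarts R t) (hne : (walkStarts R t).Nonempty) :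
    ∃ x : ℕ → α, ∀ m, R (x m) (x (m + 1)) := by
  have hstep : ∀ p : walkStarts R t, ∃ q : walkStarts R t, R p q := by
    rintro ⟨p, hp⟩
    obtain ⟨q, hq, hpq⟩ := h.symm.subset hp
    exact ⟨⟨q, hq⟩, hpq⟩
  choose next hnext using hstep
  obtain ⟨p, hp⟩ := hne
  refine ⟨fun m => (next^[m] ⟨p, hp⟩ : walkStarts R t), fun m => ?_⟩
  simp only [Function.iterate_succ_apply']
  exact hnext _

theorem exists_walk_iff_walkStarts_card_nonempty [Finite α] (R : α → α → Prop) :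
    (∃ x : ℕ → α, ∀ m, R (x m) (x (m + 1))) ↔ (walkStarts R (Nat.card α)).Nonempty := by
  constructor
  · rintro ⟨x, hx⟩
    have hmem : ∀ t m, x m ∈ walkStarts R t := by
      intro t
      induction t with
      | zero => exact fun _ => Set.mem_univ _
      | succ t ih => exact fun m => ⟨x (m + 1), ih _, hx m⟩
    exact ⟨x 0, hmem _ _⟩
  · intro hne
    by_contra hno
    have hbound : ∀ t ≤ Nat.card α, (walkStarts R t).ncard + t ≤ Nat.card α := by
      intro t ht
      induction t with
      | zero => simp [walkStarts, Set.ncard_univ]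
      | succ t ih =>
        have hlt : (walkStarts R (t + 1)).ncard < (walkStarts R t).ncard := by
          refine Set.ncard_lt_ncard ((walkStarts_antitone R t.le_succ).ssubset_of_ne ?_)
          exact fun h => hno <| exists_walk_of_walkStarts_succ_eq h <|
            hne.mono (walkStarts_antitone R (by omega))
        have := ih (by omega)
        omega
    have hpos := (Set.ncard_pos (Set.toFinite _)).2 hne
    have := hbound _ le_rfl
    omega

/-- The number whose `i`-th binary digit, for `i < n`, is `p i`. -/
def bitmask (p : ℕ → Bool) : ℕ → ℕ
  | 0 => 0
  | n + 1 => bif p n then bitmask p n ||| 2 ^ n else bitmask p n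

theorem testBit_bitmask (p : ℕ → Bool) (n i : ℕ) :
    (bitmask p n).testBit i = (decide (i < n) && p i) := by
  induction n with
  | zero => simp [bitmask]
  | succ n ih =>
    rcases lt_trichotomy i n with h | rfl | h
    · cases hp : p n <;> simp [bitmask, hp, ih, h, h.ne', Nat.lt_succ_of_lt h]
    · cases hp : p i <;> simp [bitmask, hp, ih]
    · cases hp : p n <;>
        simp [bitmask, hp, ih, h.ne, h.not_gt, show ¬ i < n + 1 by omega]

/-- The vertices below `N` with a successor in the set with bitmask `m`. -/
def pruneStep (N : ℕ) (succ : ℕ → List ℕ) (m : ℕ) : ℕ :=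
  bitmask (fun p => (succ p).any fun q => m.testBit q) N

/-- Whether `fuel` rounds of pruning empty the set with bitmask `m`. -/
def isAcyclicFrom (N : ℕ) (succ : ℕ → List ℕ) : ℕ → ℕ → Bool
  | 0, m => Nat.beq m 0
  | fuel + 1, m =>
      bif Nat.beq (pruneStep N succ m) m then Nat.beq m 0
      else isAcyclicFrom N succ fuel (pruneStep N succ m)

/-- Whether the graph on `{0, …, N - 1}` with successor lists `succ` has no infinite walk. -/
def isAcyclic (N : ℕ) (succ : ℕ → List ℕ) : Bool :=
  isAcyclicFrom N succ N (2 ^ N - 1)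

theorem isAcyclicFrom_iff (N : ℕ) (succ : ℕ → List ℕ) (fuel m : ℕ) :
    isAcyclicFrom N succ fuel m = true ↔ (pruneStep N succ)^[fuel] m = 0 := by
  induction fuel generalizing m with
  | zero => simp [isAcyclicFrom]
  | succ fuel ih =>
    by_cases h : pruneStep N succ m = m
    · simp [isAcyclicFrom, h, Function.iterate_fixed h]
    · have hb : Nat.beq (pruneStep N succ m) m = false := by
        rw [← Bool.not_eq_true, Nat.beq_eq]
        exact h
      simp [isAcyclicFrom, hb, ih]

theorem testBit_iterate_pruneStep {N : ℕ} (e : α ≃ Fin N) {R : α → α → Prop}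
    {succ : ℕ → List ℕ} (h : ∀ p q, R p q ↔ (e q : ℕ) ∈ succ (e p)) (t i : ℕ) :
    ((pruneStep N succ)^[t] (2 ^ N - 1)).testBit i = true ↔
      ∃ p ∈ walkStarts R t, (e p : ℕ) = i := by
  induction t generalizing i with
  | zero =>
    simp only [Function.iterate_zero, id, Nat.testBit_two_pow_sub_one, decide_eq_true_eq,
      walkStarts, Set.mem_univ, true_and]
    exact ⟨fun hi => ⟨e.symm ⟨i, hi⟩, by simp⟩, fun ⟨p, hp⟩ => hp ▸ (e p).isLt⟩
  | succ t ih =>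
    rw [Function.iterate_succ_apply']
    simp only [pruneStep, testBit_bitmask, Bool.and_eq_true, decide_eq_true_eq, List.any_eq_true]
    constructor
    · rintro ⟨hi, j, hj, hbit⟩
      obtain ⟨q, hq, rfl⟩ := (ih j).1 hbit
      exact ⟨e.symm ⟨i, hi⟩, ⟨q, hq, (h _ _).2 (by simpa using hj)⟩, by simp⟩
    · rintro ⟨p, ⟨q, hq, hpq⟩, rfl⟩
      exact ⟨(e p).isLt, _, (h _ _).1 hpq, (ih _).2 ⟨q, hq, rfl⟩⟩

theorem isAcyclic_iff {N : ℕ} (e : α ≃ Fin N) {R : α → α → Prop} {succ : ℕ → List ℕ}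
    (h : ∀ p q, R p q ↔ (e q : ℕ) ∈ succ (e p)) :
    isAcyclic N succ = true ↔ ¬ ∃ x : ℕ → α, ∀ m, R (x m) (x (m + 1)) := by
  have : Finite α := Finite.of_equiv _ e.symm
  have hcard : Nat.card α = N := by simp [Nat.card_congr e]
  rw [isAcyclic, isAcyclicFrom_iff, exists_walk_iff_walkStarts_card_nonempty, hcard,
    Set.not_nonempty_iff_eq_empty, Set.eq_empty_iff_forall_notMem]
  constructor
  · intro h0 p hp
    have := (testBit_iterate_pruneStep e h N (e p)).2 ⟨p, hp, rfl⟩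
    simp [h0] at this
  · intro hempty
    refine Nat.eq_of_testBit_eq fun i => ?_
    rw [Nat.zero_testBit, ← Bool.not_eq_true, testBit_iterate_pruneStep e h]
    exact fun ⟨p, hp, _⟩ => hempty p hp

end Walks

section Conditions

variable {n k : ℕ}

/-- The maps `f_i^σ` acting diagonally on pairs of distinct words. -/
def cuntzRelB (σ : Equiv.Perm (Fin (k + 1) → Fin n)) (p q : (Fin k → Fin n) × (Fin k → Fin n)) :
    Prop :=
  p.1 ≠ p.2 ∧ ∃ i, q = (Fin.init (σ (Fin.cons i p.1)), Fin.init (σ (Fin.cons i p.2)))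

/-- The maps `f_{ij}^σ` on pairs of distinct words, where they do not yield `†`. -/
def cuntzRelD (σ : Equiv.Perm (Fin (k + 1) → Fin n)) (p q : (Fin k → Fin n) × (Fin k → Fin n)) :
    Prop :=
  p.1 ≠ p.2 ∧ ∃ i j, σ (Fin.cons i p.1) (Fin.last k) = σ (Fin.cons j p.2) (Fin.last k) ∧
    q = (Fin.init (σ (Fin.cons i p.1)), Fin.init (σ (Fin.cons j p.2)))

theorem cuntzCondB_iff_not_exists_walk (σ : Equiv.Perm (Fin (k + 1) → Fin n)) :
    cuntzCondB σ ↔ ¬ ∃ x : ℕ → _, ∀ m, cuntzRelB σ (x m) (x (m + 1)) := by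
  constructor
  · rintro hB ⟨x, hx⟩
    choose seq hseq using fun m => (hx m).2
    have hchain : ∀ m, x m = (cuntzChainB σ seq (x 0).1 m, cuntzChainB σ seq (x 0).2 m) := by
      intro m
      induction m with
      | zero => rfl
      | succ m ih => rw [hseq m, ih]; rfl
    obtain ⟨m, -, hm⟩ := hB _ _ (hx 0).1 seq
    have := (hx m).1
    rw [hchain m] at this
    exact this hm
  · intro hno α β hαβ seq
    by_contra! hne
    refine hno ⟨fun m => (cuntzChainB σ seq α m, cuntzChainB σ seq β m), fun m => ⟨?_, seq m, rfl⟩⟩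
    cases m with
    | zero => exact hαβ
    | succ m => exact hne _ (by omega)

theorem cuntzRelD_iff_cuntzStepD (σ : Equiv.Perm (Fin (k + 1) → Fin n))
    (p q : (Fin k → Fin n) × (Fin k → Fin n)) :
    cuntzRelD σ p q ↔ p.1 ≠ p.2 ∧ ∃ ij, cuntzStepD σ ij (some p) = some q := by
  simp only [cuntzRelD, cuntzStepD, Prod.exists, Option.ite_none_right_eq_some, Option.some.injEq,
    eq_comm (a := q)]

theorem ne_of_cuntzStepD_eq_some {σ : Equiv.Perm (Fin (k + 1) → Fin n)} {ij : Fin n × Fin n}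
    {p q : (Fin k → Fin n) × (Fin k → Fin n)} (hp : p.1 ≠ p.2)
    (h : cuntzStepD σ ij (some p) = some q) : q.1 ≠ q.2 := by
  simp only [cuntzStepD, Option.ite_none_right_eq_some, Option.some.injEq] at h
  obtain ⟨hlast, rfl⟩ := h
  intro hinit
  have hσ : σ (Fin.cons ij.1 p.1) = σ (Fin.cons ij.2 p.2) := by
    rw [← Fin.snoc_init_self (σ (Fin.cons ij.1 p.1)), ← Fin.snoc_init_self (σ (Fin.cons ij.2 p.2)),
      hlast]
    exact congrArg (fun w => Fin.snoc (α := fun _ => Fin n) w _) hinit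
  exact hp (Fin.cons_inj.1 (σ.injective hσ)).2

theorem cuntzCondD_iff_not_exists_walk (σ : Equiv.Perm (Fin (k + 1) → Fin n)) :
    cuntzCondD σ ↔ ¬ ∃ x : ℕ → _, ∀ m, cuntzRelD σ (x m) (x (m + 1)) := by
  simp only [cuntzRelD_iff_cuntzStepD]
  constructor
  · rintro hD ⟨x, hx⟩
    choose seq hseq using fun m => (hx m).2
    have hchain : ∀ m, cuntzChainD σ seq (some (x 0)) m = some (x m) := by
      intro m
      induction m with
      | zero => rfl
      | succ m ih => rw [cuntzChainD, ih, hseq m]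
    obtain ⟨m, -, hm⟩ := hD (some (x 0)) (by rintro q ⟨⟩; exact (hx 0).1) seq
    simp [hchain] at hm
  · intro hno x hx seq
    by_contra! hne
    have hsome : ∀ m, ∃ q, cuntzChainD σ seq x m = some q := by
      intro m
      rw [← Option.ne_none_iff_exists']
      cases m with
      | zero =>
        rintro rfl
        exact hne 1 le_rfl rfl
      | succ m => exact hne _ (by omega)
    choose y hy using hsome
    have hstep : ∀ m, cuntzStepD σ (seq m) (some (y m)) = some (y (m + 1)) := fun m => by
      rw [← hy m, ← hy (m + 1), cuntzChainD]
    have hdist : ∀ m, (y m).1 ≠ (y m).2 := by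
      intro m
      induction m with
      | zero => exact hx _ (hy 0)
      | succ m ih => exact ne_of_cuntzStepD_eq_some ih (hstep m)
    exact hno ⟨y, fun m => ⟨hdist m, seq m, hstep m⟩⟩

end Conditions

section Tables

/-- The value at `(i, v)` of the function `{0, 1} × {0, 1, 2, 3} → {0, 1, 2, 3}` whose two rows
have the base 4 digits of `a` and `b` as values. -/
def initCode (a b i v : ℕ) : ℕ := (bif Nat.beq i 0 then a else b) / 4 ^ v % 4

/-- The value at `(i, v)` of the function `{0, 1} × {0, 1, 2, 3} → {0, 1}` whose values are the
binary digits of `l`. -/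
def lastCode (l i v : ℕ) : ℕ := l / 2 ^ (v + 4 * i) % 2

/-- The successors of a numbered pair of words under the maps `f_i` acting diagonally. -/
def succB (a b p : ℕ) : List ℕ :=
  bif Nat.beq (p / 4) (p % 4) then []
  else [0, 1].map fun i => initCode a b i (p % 4) + 4 * initCode a b i (p / 4)

/-- The successors of a numbered pair of words under the maps `f_{ij}`. -/
def succD (a b l p : ℕ) : List ℕ :=
  bif Nat.beq (p / 4) (p % 4) then []
  else (([0, 1] ×ˢ [0, 1]).filter fun ij =>
      Nat.beq (lastCode l ij.1 (p / 4)) (lastCode l ij.2 (p % 4))).map fun ij =>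
    initCode a b ij.2 (p % 4) + 4 * initCode a b ij.1 (p / 4)

/-- Whether no value of `initCode a b` is taken three times. -/
def initTwoToOne (a b : ℕ) : Bool :=
  (List.range 8).all fun x => (List.range x).all fun y =>
    !Nat.beq (initCode a b (x / 4) (x % 4)) (initCode a b (y / 4) (y % 4)) ||
      (List.range y).all fun z =>
        !Nat.beq (initCode a b (x / 4) (x % 4)) (initCode a b (z / 4) (z % 4))

/-- Whether `initCode a b` and `lastCode l` together separate points. -/
def tableInjective (a b l : ℕ) : Bool :=
  (List.range 8).all fun x => (List.range x).all fun y =>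
    !Nat.beq (initCode a b (x / 4) (x % 4)) (initCode a b (y / 4) (y % 4)) ||
      !Nat.beq (lastCode l (x / 4) (x % 4)) (lastCode l (y / 4) (y % 4))

/-- The rows on their own compatible with condition (b). -/
def goodRows : List ℕ :=
  [0, 5, 8, 12, 16, 21, 22, 28, 34, 41, 42, 46, 48, 53, 56, 60, 64, 69, 71, 72, 80, 85, 86, 87,
    98, 105, 106, 107, 112, 117, 118, 119, 128, 133, 136, 140, 144, 149, 150, 151, 162, 163,
    169, 170, 171, 173, 174, 175, 195, 203, 205, 207, 211, 221, 222, 223, 242, 243, 249,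
    250, 251, 253, 254, 255]

/-- The pairs of rows compatible with injectivity and condition (b). -/
def goodRowPairs : List (ℕ × ℕ) :=
  [(5, 175), (5, 250), (34, 119), (34, 221), (60, 105), (60, 150), (80, 175), (80, 250),
    (105, 60), (105, 195), (119, 34), (119, 136), (136, 119), (136, 221), (150, 60),
    (150, 195), (175, 5), (175, 80), (195, 105), (195, 150), (221, 34), (221, 136),
    (250, 5), (250, 80)]

/-- The codes of the permutations satisfying conditions (b) and (d). -/
def goodTables : List ((ℕ × ℕ) × ℕ) :=
  (goodRowPairs ×ˢ List.range 256).filter fun c =>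
    tableInjective c.1.1 c.1.2 c.2 && isAcyclic 16 (succD c.1.1 c.1.2 c.2)

theorem goodRows_eq : (List.range 256).filter (fun a => isAcyclic 16 (succB a a)) = goodRows := by
  decide +kernel

theorem goodRowPairs_eq : ((goodRows ×ˢ goodRows).filter fun c =>
    initTwoToOne c.1 c.2 && isAcyclic 16 (succB c.1 c.2)) = goodRowPairs := by
  decide +kernel

theorem length_goodTables : goodTables.length = 48 := by
  decide +kernel

theorem nodup_goodTables : goodTables.Nodup := by
  have hrows : goodRows.Nodup := goodRows_eq ▸ List.nodup_range.filter _
  have hpairs : goodRowPairs.Nodup := goodRowPairs_eq ▸ (hrows.product hrows).filter _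
  exact (hpairs.product List.nodup_range).filter _

theorem initCode_lt (a b i v : ℕ) : initCode a b i v < 4 := Nat.mod_lt _ (by decide)

theorem lastCode_lt (l i v : ℕ) : lastCode l i v < 2 := Nat.mod_lt _ (by decide)

theorem tableInjective_iff (a b l : ℕ) :
    tableInjective a b l = true ↔ ∀ x < 8, ∀ y < 8,
      initCode a b (x / 4) (x % 4) = initCode a b (y / 4) (y % 4) →
      lastCode l (x / 4) (x % 4) = lastCode l (y / 4) (y % 4) → x = y := by
  simp only [tableInjective, List.all_eq_true, List.mem_range, Bool.or_eq_true, Bool.not_eq_true',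
    ← Bool.not_eq_true, Nat.beq_eq]
  constructor
  · intro h x hx y hy hp hl
    rcases lt_trichotomy x y with hxy | hxy | hxy
    · exact ((h y hy x hxy).elim (· hp.symm) (· hl.symm)).elim
    · exact hxy
    · exact ((h x hx y hxy).elim (· hp) (· hl)).elim
  · intro h x hx y hy
    by_contra! hne
    exact hy.ne' (h x hx y (hy.trans hx) hne.1 hne.2)

theorem initTwoToOne_of_tableInjective {a b l : ℕ} (h : tableInjective a b l = true) :
    initTwoToOne a b = true := by
  rw [tableInjective_iff] at h
  simp only [initTwoToOne, List.all_eq_true, List.mem_range, Bool.or_eq_true, Bool.not_eq_true',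
    ← Bool.not_eq_true, Nat.beq_eq]
  intro x hx y hy
  by_contra! hne
  obtain ⟨hxy, z, hz, hxz⟩ := hne
  have hxy' := mt (h x hx y (by omega) hxy) (by omega)
  have hxz' := mt (h x hx z (by omega) hxz) (by omega)
  have hyz' := mt (h y (by omega) z (by omega) (hxy.symm.trans hxz)) (by omega)
  have := lastCode_lt l (x / 4) (x % 4)
  have := lastCode_lt l (y / 4) (y % 4)
  have := lastCode_lt l (z / 4) (z % 4)
  omega

theorem digits_eq {a a' : ℕ} (ha : a < 256) (ha' : a' < 256)
    (h : ∀ v < 4, a / 4 ^ v % 4 = a' / 4 ^ v % 4) : a = a' := by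
  have h0 := h 0 (by decide)
  have h1 := h 1 (by decide)
  have h2 := h 2 (by decide)
  have h3 := h 3 (by decide)
  norm_num at h0 h1 h2 h3
  omega

theorem bits_eq {l l' : ℕ} (hl : l < 256) (hl' : l' < 256)
    (h : ∀ x < 8, l / 2 ^ x % 2 = l' / 2 ^ x % 2) : l = l' := by
  refine Nat.eq_of_testBit_eq fun x => ?_
  rcases lt_or_ge x 8 with hx | hx
  · simp only [Nat.testBit_eq_decide_div_mod_eq, h x hx]
  · rw [Nat.testBit_lt_two_pow (hl.trans_le (Nat.pow_le_pow_right two_pos hx)),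
      Nat.testBit_lt_two_pow (hl'.trans_le (Nat.pow_le_pow_right two_pos hx))]

/-- The numbering of words of length 2. -/
def wordEquiv : (Fin 2 → Fin 2) ≃ Fin 4 := finFunctionFinEquiv

/-- The numbering of pairs of words of length 2. -/
def wordPairEquiv : (Fin 2 → Fin 2) × (Fin 2 → Fin 2) ≃ Fin 16 :=
  (wordEquiv.prodCongr wordEquiv).trans finProdFinEquiv

/-- The table `((a, b), l)` lists the values of the permutation `σ`. -/
structure IsTableOf (c : (ℕ × ℕ) × ℕ) (σ : Equiv.Perm (Fin 3 → Fin 2)) : Prop where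
  fst_lt : c.1.1 < 256
  snd_lt : c.1.2 < 256
  last_lt : c.2 < 256
  init_eq : ∀ i α, (wordEquiv (Fin.init (σ (Fin.cons i α))) : ℕ) =
    initCode c.1.1 c.1.2 i (wordEquiv α)
  last_eq : ∀ i α, (σ (Fin.cons i α) (Fin.last 2) : ℕ) = lastCode c.2 i (wordEquiv α)

theorem wordPairEquiv_apply (p : (Fin 2 → Fin 2) × (Fin 2 → Fin 2)) :
    (wordPairEquiv p : ℕ) = wordEquiv p.2 + 4 * wordEquiv p.1 := rfl

theorem wordPairEquiv_div (p : (Fin 2 → Fin 2) × (Fin 2 → Fin 2)) :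
    (wordPairEquiv p : ℕ) / 4 = wordEquiv p.1 := by
  have := (wordEquiv p.2).isLt
  rw [wordPairEquiv_apply]
  omega

theorem wordPairEquiv_mod (p : (Fin 2 → Fin 2) × (Fin 2 → Fin 2)) :
    (wordPairEquiv p : ℕ) % 4 = wordEquiv p.2 := by
  have := (wordEquiv p.2).isLt
  rw [wordPairEquiv_apply]
  omega

theorem eq_mk_iff_wordPairEquiv_eq (q : (Fin 2 → Fin 2) × (Fin 2 → Fin 2)) (α β : Fin 2 → Fin 2) :
    q = (α, β) ↔ (wordEquiv β : ℕ) + 4 * wordEquiv α = wordPairEquiv q := by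
  rw [← wordPairEquiv.injective.eq_iff, Fin.ext_iff, eq_comm, wordPairEquiv_apply (α, β)]

namespace IsTableOf

variable {a b l : ℕ} {σ : Equiv.Perm (Fin 3 → Fin 2)}

theorem cuntzRelB_iff (h : IsTableOf ((a, b), l) σ) (p q : (Fin 2 → Fin 2) × (Fin 2 → Fin 2)) :
    cuntzRelB σ p q ↔ (wordPairEquiv q : ℕ) ∈ succB a b (wordPairEquiv p) := by
  rw [cuntzRelB, succB, wordPairEquiv_div, wordPairEquiv_mod]
  by_cases hp : p.1 = p.2
  · simp [hp]
  · have hb : Nat.beq (wordEquiv p.1) (wordEquiv p.2) = false := by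
      rw [← Bool.not_eq_true, Nat.beq_eq, Fin.val_inj, wordEquiv.injective.eq_iff]
      exact hp
    simp [hp, hb, eq_mk_iff_wordPairEquiv_eq, h.init_eq, Fin.exists_fin_two,
      eq_comm (b := (wordPairEquiv q : ℕ))]

theorem cuntzRelD_iff (h : IsTableOf ((a, b), l) σ) (p q : (Fin 2 → Fin 2) × (Fin 2 → Fin 2)) :
    cuntzRelD σ p q ↔ (wordPairEquiv q : ℕ) ∈ succD a b l (wordPairEquiv p) := by
  rw [cuntzRelD, succD, wordPairEquiv_div, wordPairEquiv_mod]
  by_cases hp : p.1 = p.2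
  · simp [hp]
  · have hb : Nat.beq (wordEquiv p.1) (wordEquiv p.2) = false := by
      rw [← Bool.not_eq_true, Nat.beq_eq, Fin.val_inj, wordEquiv.injective.eq_iff]
      exact hp
    simp only [ne_eq, hp, not_false_eq_true, true_and, hb, cond_false, List.mem_map, List.mem_filter,
      Nat.beq_eq, Prod.exists, List.mem_product, List.mem_cons, List.not_mem_nil, or_false,
      eq_mk_iff_wordPairEquiv_eq, h.init_eq, Fin.exists_fin_two, Fin.ext_iff, h.last_eq]
    simp [or_and_right, exists_or, and_assoc, or_assoc]

theorem cuntzCondB_iff (h : IsTableOf ((a, b), l) σ) :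
    cuntzCondB σ ↔ isAcyclic 16 (succB a b) = true := by
  rw [cuntzCondB_iff_not_exists_walk, isAcyclic_iff wordPairEquiv h.cuntzRelB_iff]

theorem cuntzCondD_iff (h : IsTableOf ((a, b), l) σ) :
    cuntzCondD σ ↔ isAcyclic 16 (succD a b l) = true := by
  rw [cuntzCondD_iff_not_exists_walk, isAcyclic_iff wordPairEquiv h.cuntzRelD_iff]

end IsTableOf

theorem isAcyclic_succB_of_subset {a b a' b' : ℕ} (hsub : ∀ p, succB a' b' p ⊆ succB a b p)
    (h : isAcyclic 16 (succB a b) = true) : isAcyclic 16 (succB a' b') = true := by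
  have hab := (isAcyclic_iff (Equiv.refl (Fin 16)) fun _ _ => Iff.rfl).1 h
  refine (isAcyclic_iff (Equiv.refl (Fin 16)) fun _ _ => Iff.rfl).2 fun ⟨x, hx⟩ => ?_
  exact hab ⟨x, fun m => hsub _ (hx m)⟩

theorem mem_goodTables_iff {a b l : ℕ} :
    ((a, b), l) ∈ goodTables ↔ a < 256 ∧ b < 256 ∧ l < 256 ∧ tableInjective a b l = true ∧
      isAcyclic 16 (succB a b) = true ∧ isAcyclic 16 (succD a b l) = true := by
  have hleft : isAcyclic 16 (succB a b) = true → isAcyclic 16 (succB a a) = true :=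
    isAcyclic_succB_of_subset fun p => by
      cases hp : Nat.beq (p / 4) (p % 4) <;> simp [succB, hp, initCode, Nat.beq]
  have hright : isAcyclic 16 (succB a b) = true → isAcyclic 16 (succB b b) = true :=
    isAcyclic_succB_of_subset fun p => by
      cases hp : Nat.beq (p / 4) (p % 4) <;> simp [succB, hp, initCode, Nat.beq]
  have htwo := @initTwoToOne_of_tableInjective a b l
  rw [goodTables, ← goodRowPairs_eq, ← goodRows_eq]
  simp only [List.mem_filter, List.mem_product, List.mem_range, Bool.and_eq_true]
  tauto

theorem IsTableOf.tableInjective {a b l : ℕ} {σ : Equiv.Perm (Fin 3 → Fin 2)}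
    (h : IsTableOf ((a, b), l) σ) : tableInjective a b l = true := by
  rw [tableInjective_iff]
  intro x hx y hy hp hl
  set i : Fin 2 := ⟨x / 4, by omega⟩ with hi
  set j : Fin 2 := ⟨y / 4, by omega⟩ with hj
  set α := wordEquiv.symm ⟨x % 4, by omega⟩ with hα
  set β := wordEquiv.symm ⟨y % 4, by omega⟩ with hβ
  have hinit : Fin.init (σ (Fin.cons i α)) = Fin.init (σ (Fin.cons j β)) := by
    rw [← wordEquiv.injective.eq_iff, Fin.ext_iff, h.init_eq, h.init_eq]
    simpa [hi, hj, hα, hβ] using hp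
  have hlast : σ (Fin.cons i α) (Fin.last 2) = σ (Fin.cons j β) (Fin.last 2) := by
    rw [Fin.ext_iff, h.last_eq, h.last_eq]
    simpa [hi, hj, hα, hβ] using hl
  have hσ : σ (Fin.cons i α) = σ (Fin.cons j β) := by
    rw [← Fin.snoc_init_self (σ (Fin.cons i α)), ← Fin.snoc_init_self (σ (Fin.cons j β)), hlast]
    exact congrArg (fun w => Fin.snoc (α := fun _ => Fin 2) w _) hinit
  obtain ⟨hij, hαβ⟩ := Fin.cons_inj.1 (σ.injective hσ)
  have hdiv : x / 4 = y / 4 := Fin.ext_iff.1 hij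
  have hmod : x % 4 = y % 4 := Fin.ext_iff.1 (wordEquiv.symm.injective hαβ)
  omega

theorem IsTableOf.table_unique {c c' : (ℕ × ℕ) × ℕ} {σ : Equiv.Perm (Fin 3 → Fin 2)}
    (h : IsTableOf c σ) (h' : IsTableOf c' σ) : c = c' := by
  have hdigit : ∀ i : Fin 2, ∀ v < 4,
      initCode c.1.1 c.1.2 i v = initCode c'.1.1 c'.1.2 i v := by
    intro i v hv
    simpa using (h.init_eq i (wordEquiv.symm ⟨v, hv⟩)).symm.trans (h'.init_eq i _)
  refine Prod.ext (Prod.ext ?_ ?_) ?_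
  · exact digits_eq h.fst_lt h'.fst_lt (hdigit 0)
  · exact digits_eq h.snd_lt h'.snd_lt (hdigit 1)
  · refine bits_eq h.last_lt h'.last_lt fun x hx => ?_
    have := (h.last_eq ⟨x / 4, by omega⟩ (wordEquiv.symm ⟨x % 4, by omega⟩)).symm.trans
      (h'.last_eq _ _)
    simpa [lastCode, Nat.mod_add_div] using this

theorem IsTableOf.perm_unique {c : (ℕ × ℕ) × ℕ} {σ τ : Equiv.Perm (Fin 3 → Fin 2)}
    (h : IsTableOf c σ) (h' : IsTableOf c τ) : σ = τ := by
  refine Equiv.ext fun w => ?_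
  rw [← Fin.cons_self_tail w, ← Fin.snoc_init_self (σ _), ← Fin.snoc_init_self (τ _)]
  congr 1
  · rw [← wordEquiv.injective.eq_iff, Fin.ext_iff, h.init_eq, h'.init_eq]
  · rw [Fin.ext_iff, h.last_eq, h'.last_eq]

theorem exists_isTableOf (σ : Equiv.Perm (Fin 3 → Fin 2)) : ∃ c, IsTableOf c σ := by
  let row (i : Fin 2) : Fin (4 ^ 4) :=
    finFunctionFinEquiv fun v => wordEquiv (Fin.init (σ (Fin.cons i (wordEquiv.symm v))))
  let l : Fin (2 ^ 8) := finFunctionFinEquiv fun x =>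
    σ (Fin.cons (finProdFinEquiv.symm x : Fin 2 × Fin 4).1
      (wordEquiv.symm (finProdFinEquiv.symm x : Fin 2 × Fin 4).2)) (Fin.last 2)
  have hrow (i : Fin 2) (v : Fin 4) : (row i : ℕ) / 4 ^ (v : ℕ) % 4 =
      wordEquiv (Fin.init (σ (Fin.cons i (wordEquiv.symm v)))) :=
    Fin.ext_iff.1 (congrFun (finFunctionFinEquiv.symm_apply_apply _) v)
  have hl (i : Fin 2) (v : Fin 4) : (l : ℕ) / 2 ^ (v + 4 * i : ℕ) % 2 =
      σ (Fin.cons i (wordEquiv.symm v)) (Fin.last 2) := by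
    have := Fin.ext_iff.1 (congrFun (finFunctionFinEquiv.symm_apply_apply fun x =>
      σ (Fin.cons (finProdFinEquiv.symm x : Fin 2 × Fin 4).1
        (wordEquiv.symm (finProdFinEquiv.symm x : Fin 2 × Fin 4).2)) (Fin.last 2))
      (finProdFinEquiv (i, v)))
    exact this.trans (by simp only [Equiv.symm_apply_apply])
  refine ⟨((row 0, row 1), l), (row 0).isLt, (row 1).isLt, l.isLt, fun i α => ?_, fun i α => ?_⟩
  · have := hrow i (wordEquiv α)
    rw [Equiv.symm_apply_apply] at this
    rw [← this]
    fin_cases i <;> rfl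
  · have := hl i (wordEquiv α)
    rw [Equiv.symm_apply_apply] at this
    exact this.symm

theorem exists_perm_isTableOf {a b l : ℕ} (ha : a < 256) (hb : b < 256) (hl : l < 256)
    (h : tableInjective a b l = true) : ∃ σ, IsTableOf ((a, b), l) σ := by
  rw [tableInjective_iff] at h
  let f (w : Fin 3 → Fin 2) : Fin 3 → Fin 2 :=
    Fin.snoc (α := fun _ => Fin 2)
      (wordEquiv.symm ⟨initCode a b (w 0) (wordEquiv (Fin.tail w)), initCode_lt ..⟩)
      ⟨lastCode l (w 0) (wordEquiv (Fin.tail w)), lastCode_lt ..⟩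
  have hf : f.Injective := by
    intro w w' hww
    obtain ⟨hinit, hlast⟩ := Fin.snoc_inj.1 hww
    have hp := Fin.ext_iff.1 (wordEquiv.symm.injective hinit)
    have hla := Fin.ext_iff.1 hlast
    have hcode (u : Fin 3 → Fin 2) : ((wordEquiv (Fin.tail u) : ℕ) + 4 * u 0) / 4 = u 0 ∧
        ((wordEquiv (Fin.tail u) : ℕ) + 4 * u 0) % 4 = wordEquiv (Fin.tail u) ∧
        (wordEquiv (Fin.tail u) : ℕ) + 4 * u 0 < 8 := by
      have := (wordEquiv (Fin.tail u)).isLt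
      have := (u 0).isLt
      omega
    obtain ⟨hd, hm, hlt⟩ := hcode w
    obtain ⟨hd', hm', hlt'⟩ := hcode w'
    have heq := h _ hlt _ hlt' (by rw [hd, hm, hd', hm']; exact hp)
      (by rw [hd, hm, hd', hm']; exact hla)
    rw [← Fin.cons_self_tail w, ← Fin.cons_self_tail w']
    have h0 : w 0 = w' 0 := Fin.ext (by rw [← hd, heq, hd'])
    have ht : Fin.tail w = Fin.tail w' := wordEquiv.injective (Fin.ext (by rw [← hm, heq, hm']))
    rw [h0, ht]
  refine ⟨Equiv.ofBijective f (Finite.injective_iff_bijective.1 hf), ha, hb, hl, ?_, ?_⟩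
  · intro i α
    simp [f]
  · intro i α
    simp only [f, Equiv.ofBijective_apply, Fin.snoc_last, Fin.cons_zero, Fin.tail_cons]

end Tables

/-- for `n = 2`, `k = 3`, exactly 48 of the `8! = 40320`
permutations of `W_2^3` satisfy both condition (b) and condition (d). -/
theorem stmt16 :
    Nat.card (Equiv.Perm (Fin 3 → Fin 2)) = 40320 ∧
      Nat.card {σ : Equiv.Perm (Fin 3 → Fin 2) // cuntzCondB σ ∧ cuntzCondD σ} = 48 := by
  constructor
  · simp [Nat.card_eq_fintype_card, Fintype.card_perm, Nat.factorial]
  · choose table htable using exists_isTableOf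
    have hbij : Set.BijOn table {σ | cuntzCondB σ ∧ cuntzCondD σ} goodTables.toFinset := by
      refine ⟨fun σ ⟨hB, hD⟩ => ?_, fun σ _ τ _ h => ?_, fun c hc => ?_⟩
      · have h := htable σ
        exact List.mem_toFinset.2 <| mem_goodTables_iff.2 ⟨h.fst_lt, h.snd_lt, h.last_lt,
          h.tableInjective, h.cuntzCondB_iff.1 hB, h.cuntzCondD_iff.1 hD⟩
      · exact (htable σ).perm_unique (h ▸ htable τ)
      · obtain ⟨ha, hb, hl, hinj, hB, hD⟩ := mem_goodTables_iff.1 (List.mem_toFinset.1 hc)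
        obtain ⟨σ, hσ⟩ := exists_perm_isTableOf ha hb hl hinj
        exact ⟨σ, ⟨hσ.cuntzCondB_iff.2 hB, hσ.cuntzCondD_iff.2 hD⟩, (htable σ).table_unique hσ⟩
    have hcard := hbij.ncard_eq
    rw [Set.ncard_coe_finset, List.toFinset_card_of_nodup nodup_goodTables,
      length_goodTables] at hcard
    exact hcard
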